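/- Let m ≥ 1, let x : Fin(2m+1) → Bool, and let i ∈ Fin(2m+1) be such that Σ_{j ≠ i} x̂_j ≠ 0, where x̂_j = (−1)^{x_j}, i.e., x̂_j = −1 if x_j = true and x̂_j = 1 if x_j = false. Then for every j ∈ Fin(2m+1) with j ≠ i: the number of indices l with x_l = true is at least m+1 if and only if the number of indices l with l ≠ i, l ≠ j, and x_l = true is at least m. -/

import Mathlib

open scoped BigOperators

theorem sum_sign_eq_card_sub {α : Type*} (s : Finset α) (x : α → Bool) :
    ∑ j ∈ s, (if x j then (-1 : ℤ) else 1) =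
      s.card - 2 * (s.filter (fun j => x j = true)).card := by
  rw [Finset.card_eq_sum_ones, Finset.card_filter]
  push_cast
  rw [Finset.mul_sum, ← Finset.sum_sub_distrib]
  refine Finset.sum_congr rfl fun j _ => ?_
  split_ifs <;> norm_num

theorem card_filter_erase_add {α : Type*} [DecidableEq α] {s : Finset α} {a : α} (ha : a ∈ s)
    (p : α → Prop) [DecidablePred p] :
    ((s.erase a).filter p).card + (if p a then 1 else 0) = (s.filter p).card := by
  simp only [Finset.card_filter]
  exact Finset.sum_erase_add s _ ha

theorem majority_recursion_step_singleton (m : ℕ) (hm : 1 ≤ m)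
    (x : Fin (2*m+1) → Bool) (i : Fin (2*m+1))
    (h : (∑ j ∈ Finset.univ.filter (fun j : Fin (2*m+1) => j ≠ i),
        (if x j then (-1 : ℤ) else 1)) ≠ 0) :
    ∀ j : Fin (2*m+1), j ≠ i →
      (m + 1 ≤ (Finset.univ.filter
          (fun l : Fin (2*m+1) => x l = true)).card ↔
        m ≤ (Finset.univ.filter
          (fun l : Fin (2*m+1) => l ≠ i ∧ l ≠ j ∧ x l = true)).card) := by
  intro j hji
  rw [sum_sign_eq_card_sub, Finset.filter_ne' Finset.univ i,
    Finset.card_erase_of_mem (Finset.mem_univ i), Finset.card_univ, Fintype.card_fin] at h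
  have hi := card_filter_erase_add (Finset.mem_univ i) (fun l => x l = true)
  have hj := card_filter_erase_add (Finset.mem_erase.2 ⟨hji, Finset.mem_univ j⟩)
    (fun l => x l = true)
  have hij : Finset.univ.filter (fun l => l ≠ i ∧ l ≠ j ∧ x l = true) =
      ((Finset.univ.erase i).erase j).filter (fun l => x l = true) := by
    ext l
    simp only [Finset.mem_filter, Finset.mem_erase, Finset.mem_univ]
    tauto
  rw [hij]
  split_ifs at hi hj <;> omega
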